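/- Two free BDTs φ and ψ are not equivalent if and only if either there is a leaf of φ labeled 1 and a leaf of ψ labeled 0 that are compatible, or there is a leaf of φ labeled 0 and a leaf of ψ labeled 1 that are compatible. -/

import Mathlib

/-- Binary decision trees: leaves labeled `0`/`1` (as `Bool`), inner vertices labeled
by Boolean variables; `node x l r` has left subtree `l` and right subtree `r`. -/
inductive BDT : Type
  | leaf : Bool → BDT
  | node : ℕ → BDT → BDT → BDT
deriving DecidableEq

namespace BDT

/-- Evaluation of a BDT under a valuation: go left when the variable is `false` (0),
right when it is `true` (1), and return the label of the leaf reached. -/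
def eval (v : ℕ → Bool) : BDT → Bool
  | leaf b => b
  | node x l r => if v x then r.eval v else l.eval v

/-- Two BDTs are equivalent when they compute the same Boolean function. -/
def Equiv (φ ψ : BDT) : Prop := ∀ v : ℕ → Bool, φ.eval v = ψ.eval v

/-- Variables occurring in a BDT. -/
def vars : BDT → Finset ℕ
  | leaf _ => ∅
  | node x l r => insert x (l.vars ∪ r.vars)

/-- A BDT is free when no variable occurs twice on a path from the root to a leaf. -/
def Free : BDT → Prop
  | leaf _ => True
  | node x l r => x ∉ l.vars ∧ x ∉ r.vars ∧ l.Free ∧ r.Free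

/-- A leaf of a BDT is identified by the path from the root reaching it
(`false` = left branch, `true` = right branch); `leafAt` returns its label. -/
def leafAt : BDT → List Bool → Option Bool
  | leaf b, [] => some b
  | node _ l r, d :: p => if d then r.leafAt p else l.leafAt p
  | _, _ => none

/-- The branch data of a path: the list of variables encountered from the root,
together with the direction (left = `false` / right = `true`) through which the path
leaves each of them. -/
def branch : BDT → List Bool → List (ℕ × Bool)
  | node x l r, d :: p => (x, d) :: (if d then r.branch p else l.branch p)
  | _, _ => []

/-- The path followed when evaluating a BDT under a valuation `v`. -/
def evalPath (v : ℕ → Bool) : BDT → List Bool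
  | leaf _ => []
  | node x l r => v x :: (if v x then r.evalPath v else l.evalPath v)

end BDT

/-- Two leaves, given by the path `p` to a leaf of `φ` and the path `q` to a leaf of
`ψ`, are compatible if no variable appears on both paths while being left through
opposite (left/right) branches. -/
def Compatible (φ : BDT) (p : List Bool) (ψ : BDT) (q : List Bool) : Prop :=
  ∀ (x : ℕ) (d d' : Bool), (x, d) ∈ φ.branch p → (x, d') ∈ ψ.branch q → d = d'

namespace BDT

theorem leafAt_evalPath (v : ℕ → Bool) (φ : BDT) :
    φ.leafAt (φ.evalPath v) = some (φ.eval v) := by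
  induction φ with
  | leaf b => rfl
  | node x l r ihl ihr => cases h : v x <;> simp [leafAt, evalPath, eval, h, ihl, ihr]

theorem eq_of_mem_branch_evalPath {v : ℕ → Bool} {φ : BDT} {x : ℕ} {d : Bool}
    (h : (x, d) ∈ φ.branch (φ.evalPath v)) : d = v x := by
  induction φ with
  | leaf b => simp [branch] at h
  | node y l r ihl ihr =>
    cases hy : v y <;> simp [branch, evalPath, hy] at h <;> grind

theorem eval_eq_of_leafAt {v : ℕ → Bool} {φ : BDT} {p : List Bool} {b : Bool}
    (hp : φ.leafAt p = some b) (hv : ∀ x d, (x, d) ∈ φ.branch p → v x = d) :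
    φ.eval v = b := by
  induction φ generalizing p with
  | leaf c => cases p <;> simp_all [leafAt, eval]
  | node y l r ihl ihr =>
    cases p with
    | nil => simp [leafAt] at hp
    | cons d p =>
      have hy : v y = d := hv y d (by simp [branch])
      have hv' : ∀ x e, (x, e) ∈ (if d then r.branch p else l.branch p) → v x = e :=
        fun x e he => hv x e (List.mem_cons_of_mem _ he)
      cases d with
      | false => simpa [eval, hy] using ihl hp hv'
      | true => simpa [eval, hy] using ihr hp hv'

theorem mem_vars_of_mem_branch {φ : BDT} {p : List Bool} {x : ℕ} {d : Bool}
    (h : (x, d) ∈ φ.branch p) : x ∈ φ.vars := by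
  induction φ generalizing p with
  | leaf c => simp [branch] at h
  | node y l r ihl ihr =>
    cases p with
    | nil => simp [branch] at h
    | cons e p => cases e <;> simp [branch] at h <;> grind [vars]

/-- In a free BDT, every path leaves each variable through at most one branch. -/
theorem Free.compatible_self {φ : BDT} (hφ : φ.Free) (p : List Bool) :
    Compatible φ p φ p := by
  intro x d d' h h'
  induction φ generalizing p with
  | leaf c => simp [branch] at h
  | node y l r ihl ihr =>
    obtain ⟨hl, hr, hfl, hfr⟩ := hφ
    cases p with
    | nil => simp [branch] at h
    | cons e p =>
      cases e <;> simp [branch] at h h' <;> grind [mem_vars_of_mem_branch]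

end BDT

theorem Compatible.symm {φ ψ : BDT} {p q : List Bool} (h : Compatible φ p ψ q) :
    Compatible ψ q φ p :=
  fun x d d' hd hd' => (h x d' d hd' hd).symm

/-- The valuation that sends a variable to `1` exactly when one of two given paths leaves
it to the right. -/
def pathValuation (φ : BDT) (p : List Bool) (ψ : BDT) (q : List Bool) (x : ℕ) : Bool :=
  decide ((x, true) ∈ φ.branch p ∨ (x, true) ∈ ψ.branch q)

theorem pathValuation_comm (φ : BDT) (p : List Bool) (ψ : BDT) (q : List Bool) :
    pathValuation φ p ψ q = pathValuation ψ q φ p := by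
  funext x
  simp [pathValuation, or_comm]

theorem Compatible.eval_pathValuation {φ ψ : BDT} {p q : List Bool} {b : Bool}
    (h : Compatible φ p ψ q) (hφ : φ.Free) (hp : φ.leafAt p = some b) :
    φ.eval (pathValuation φ p ψ q) = b := by
  refine BDT.eval_eq_of_leafAt hp fun x d hd => ?_
  cases d with
  | true => simp [pathValuation, hd]
  | false =>
    have h₁ : (x, true) ∉ φ.branch p := fun h' => by
      simpa using hφ.compatible_self p x _ _ hd h'
    have h₂ : (x, true) ∉ ψ.branch q := fun h' => by simpa using h x _ _ hd h'
    simp [pathValuation, h₁, h₂]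

/-- Two free BDTs `φ` and `ψ` are *not* equivalent iff there are a leaf of `φ` labeled
`1` and a leaf of `ψ` labeled `0` that are compatible, or a leaf of `φ` labeled `0`
and a leaf of `ψ` labeled `1` that are compatible. -/
theorem not_equiv_iff_compatible_leaves
    (φ ψ : BDT) (hφ : φ.Free) (hψ : ψ.Free) :
    ¬ BDT.Equiv φ ψ ↔
      ∃ (p q : List Bool),
        ((φ.leafAt p = some true ∧ ψ.leafAt q = some false) ∨
          (φ.leafAt p = some false ∧ ψ.leafAt q = some true)) ∧
        Compatible φ p ψ q := by
  constructor
  · intro h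
    obtain ⟨v, hv⟩ := not_forall.mp h
    refine ⟨φ.evalPath v, ψ.evalPath v, ?_, fun x d d' hd hd' => ?_⟩
    · rw [BDT.leafAt_evalPath, BDT.leafAt_evalPath]
      cases hb : φ.eval v <;> cases hc : ψ.eval v <;> simp_all
    · rw [BDT.eq_of_mem_branch_evalPath hd, BDT.eq_of_mem_branch_evalPath hd']
  · rintro ⟨p, q, hpq, hc⟩ h
    have hv := h (pathValuation φ p ψ q)
    rcases hpq with ⟨hp, hq⟩ | ⟨hp, hq⟩ <;>
    · rw [hc.eval_pathValuation hφ hp, pathValuation_comm,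
        hc.symm.eval_pathValuation hψ hq] at hv
      simp at hv
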